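/- Let (Ω, 𝔉, P) be a probability space, 𝒵 a measurable space, (Z_h)_{h∈ℕ} and (Y_h)_{h∈ℕ} sequences of 𝒵-valued random variables, and τ an ℕ-valued random variable such that, P-almost surely, Z_h(ω) = Y_h(ω) for every h ≥ τ(ω). Let m ≥ 1 be an integer with P(τ > h) ≤ (1/4)^{⌊h/m⌋} for every h ∈ ℕ, and let f_h : 𝒵 → ℝ^d (h ∈ ℕ) be measurable functions with ‖f_h(z)‖ ≤ B for all h and z. Then for every H ∈ ℕ, ‖E[Σ_{h=0}^{H−1} f_h(Z_h)] − E[Σ_{h=0}^{H−1} f_h(Y_h)]‖ ≤ (8/3) B m; in particular ‖E[Σ_{h=0}^{H−1} f_h(Z_h)]‖ ≤ ‖E[Σ_{h=0}^{H−1} f_h(Y_h)]‖ + (8/3) B m. -/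

import Mathlib

open MeasureTheory

theorem aux_block (m : ℕ) (hm : 1 ≤ m) (K : ℕ) :
    ∑ h ∈ Finset.range (K * m), (1 / 4 : ℝ) ^ (h / m) = (4 / 3) * m * (1 - (1 / 4) ^ K) := by
  induction K with
  | zero => simp
  | succ K ih =>
    rw [Nat.succ_mul, Finset.sum_range_add, ih]
    have : ∀ x ∈ Finset.range m, (1 / 4 : ℝ) ^ ((K * m + x) / m) = (1 / 4) ^ K := by
      intro x hx
      have hx' := Finset.mem_range.1 hx
      congr 1
      rw [Nat.mul_comm, Nat.mul_add_div (by omega), Nat.div_eq_of_lt hx', Nat.add_zero]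
    rw [Finset.sum_congr rfl this, Finset.sum_const, Finset.card_range, nsmul_eq_mul, pow_succ]
    ring

theorem aux_sum (m : ℕ) (hm : 1 ≤ m) (H : ℕ) :
    ∑ h ∈ Finset.range H, (1 / 4 : ℝ) ^ (h / m) ≤ (4 / 3) * m := by
  calc ∑ h ∈ Finset.range H, (1 / 4 : ℝ) ^ (h / m)
      ≤ ∑ h ∈ Finset.range (H * m), (1 / 4 : ℝ) ^ (h / m) := by
        apply Finset.sum_le_sum_of_subset_of_nonneg
        · exact Finset.range_mono (Nat.le_mul_of_pos_right H hm)
        · intros; positivity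
    _ = (4 / 3) * m * (1 - (1 / 4) ^ H) := aux_block m hm H
    _ ≤ (4 / 3) * m := by
        apply mul_le_of_le_one_right (by positivity)
        have : (0 : ℝ) ≤ (1 / 4) ^ H := by positivity
        linarith

/-- First inequality relating sums along a chain and along its stationary coupled copy. -/
theorem stmt7 {Ω 𝒵 : Type*} [MeasurableSpace Ω] [MeasurableSpace 𝒵]
    (μ : Measure Ω) [IsProbabilityMeasure μ] (d : ℕ)
    (Z Y : ℕ → Ω → 𝒵) (τ : Ω → ℕ)
    (hZ : ∀ h, Measurable (Z h)) (hY : ∀ h, Measurable (Y h)) (hτ : Measurable τ)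
    (hcouple : ∀ᵐ ω ∂μ, ∀ h, τ ω ≤ h → Z h ω = Y h ω)
    (m : ℕ) (hm : 1 ≤ m)
    (htail : ∀ h : ℕ, μ {ω | h < τ ω} ≤ ENNReal.ofReal ((1 / 4 : ℝ) ^ (h / m)))
    (B : ℝ) (f : ℕ → 𝒵 → EuclideanSpace ℝ (Fin d))
    (hf : ∀ h, Measurable (f h)) (hfB : ∀ h z, ‖f h z‖ ≤ B)
    (H : ℕ) :
    ‖(∫ ω, ∑ h ∈ Finset.range H, f h (Z h ω) ∂μ)
        - ∫ ω, ∑ h ∈ Finset.range H, f h (Y h ω) ∂μ‖ ≤ (8 / 3) * B * m ∧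
    ‖∫ ω, ∑ h ∈ Finset.range H, f h (Z h ω) ∂μ‖
      ≤ ‖∫ ω, ∑ h ∈ Finset.range H, f h (Y h ω) ∂μ‖ + (8 / 3) * B * m := by
  obtain ⟨ω₀⟩ : Nonempty Ω := nonempty_of_isProbabilityMeasure μ
  have hB : 0 ≤ B := (norm_nonneg _).trans (hfB 0 (Z 0 ω₀))
  have hint : ∀ W : ℕ → Ω → 𝒵, (∀ h, Measurable (W h)) → ∀ h,
      Integrable (fun ω => f h (W h ω)) μ := fun W hW h =>
    Integrable.of_bound ((hf h).comp (hW h)).aestronglyMeasurable B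
      (Filter.Eventually.of_forall fun ω => hfB h _)
  have hterm : ∀ h, ‖(∫ ω, f h (Z h ω) ∂μ) - ∫ ω, f h (Y h ω) ∂μ‖
      ≤ 2 * B * (1 / 4 : ℝ) ^ (h / m) := by
    intro h
    have hms : MeasurableSet {ω | h < τ ω} := measurableSet_lt measurable_const hτ
    rw [← integral_sub (hint Z hZ h) (hint Y hY h)]
    calc ‖∫ ω, (f h (Z h ω) - f h (Y h ω)) ∂μ‖
        ≤ ∫ ω, {ω | h < τ ω}.indicator (fun _ => 2 * B) ω ∂μ := by
          apply norm_integral_le_of_norm_le ((integrable_const _).indicator hms)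
          filter_upwards [hcouple] with ω hω
          by_cases hlt : h < τ ω
          · rw [Set.indicator_of_mem (by exact hlt)]
            have h1 := norm_sub_le (f h (Z h ω)) (f h (Y h ω))
            have h2 := hfB h (Z h ω)
            have h3 := hfB h (Y h ω)
            linarith
          · rw [Set.indicator_of_notMem (by exact hlt), hω h (not_lt.1 hlt)]
            simp
      _ = 2 * B * μ.real {ω | h < τ ω} := by
          rw [integral_indicator_const _ hms, smul_eq_mul, mul_comm]
      _ ≤ 2 * B * (1 / 4 : ℝ) ^ (h / m) := by
          apply mul_le_mul_of_nonneg_left _ (by positivity)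
          exact ENNReal.toReal_le_of_le_ofReal (by positivity) (htail h)
  have main : ‖(∫ ω, ∑ h ∈ Finset.range H, f h (Z h ω) ∂μ)
        - ∫ ω, ∑ h ∈ Finset.range H, f h (Y h ω) ∂μ‖ ≤ (8 / 3) * B * m := by
    rw [integral_finsetSum _ (fun h _ => hint Z hZ h),
      integral_finsetSum _ (fun h _ => hint Y hY h), ← Finset.sum_sub_distrib]
    calc _ ≤ ∑ h ∈ Finset.range H, 2 * B * (1 / 4 : ℝ) ^ (h / m) :=
          norm_sum_le_of_le _ (fun h _ => hterm h)
      _ = 2 * B * ∑ h ∈ Finset.range H, (1 / 4 : ℝ) ^ (h / m) := by rw [Finset.mul_sum]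
      _ ≤ 2 * B * ((4 / 3) * m) :=
          mul_le_mul_of_nonneg_left (aux_sum m hm H) (by positivity)
      _ = (8 / 3) * B * m := by ring
  refine ⟨main, ?_⟩
  have := norm_sub_norm_le (∫ ω, ∑ h ∈ Finset.range H, f h (Z h ω) ∂μ)
    (∫ ω, ∑ h ∈ Finset.range H, f h (Y h ω) ∂μ)
  linarith
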